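/- arXiv:2510.19534 — 2 statements merged into one kernel-verified Lean document; each statement's English description precedes it below -/
import Mathlib

section
/- Let n ≥ 1, γ = p − n, and n < p < +∞. There exists a constant C > 0, depending only on n and p, such that every function u : ℝⁿ → ℝ that is continuously differentiable on ℝⁿ₊ and has finite weighted energy E_γ(u) < +∞ satisfies, for all x, y ∈ ℝⁿ₊, |u(x) − u(y)| ≤ C · ( ln( 1 + (|x − y| / min(xₙ, yₙ))^{(p−n)/(p−1)} ) )^{1 − 1/p} · E_γ(u)^{1/p}. -/
open MeasureTheory Real Set
open scoped ENNReal

noncomputable section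

/-- The last coordinate `xₙ` of a point of `ℝⁿ`. -/
def lastCoord (n : ℕ) (x : EuclideanSpace ℝ (Fin n)) : ℝ :=
  if h : 0 < n then x ⟨n - 1, Nat.sub_lt h one_pos⟩ else 0

/-- The open upper half-space `ℝⁿ₊`. -/
def upperHalf (n : ℕ) : Set (EuclideanSpace ℝ (Fin n)) :=
  {z | 0 < lastCoord n z}

/-- The weighted energy `E_γ(u) = ∫_{ℝⁿ₊} ‖Du(z)‖^p zₙ^γ dz`, as a value in `[0, +∞]`. -/
def energy (n : ℕ) (γ p : ℝ) (u : EuclideanSpace ℝ (Fin n) → ℝ) : ℝ≥0∞ :=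
  ∫⁻ z in upperHalf n, ENNReal.ofReal (‖fderiv ℝ u z‖ ^ p * lastCoord n z ^ γ)

/-- The radial weight dual to `t ^ (d - 1) * (h + t) ^ (p - d)` integrates to a logarithm. -/
lemma lintegral_rpow_mul_add_rpow_le_log {α h T : ℝ} (hα : 0 < α) (hh : 0 < h) (hT : 0 < T) :
    ∫⁻ t in Ioc 0 T, ENNReal.ofReal (t ^ (α - 1) * (h + t) ^ (-α)) ≤
      ENNReal.ofReal (2 / α * Real.log (1 + (T / h) ^ α)) := by
  set f : ℝ → ℝ := fun t => 2 / α * Real.log (1 + (t / h) ^ α) with hf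
  set f' : ℝ → ℝ := fun t => 2 / α * (((1 / h) * α * (t / h) ^ (α - 1)) / (1 + (t / h) ^ α)) with hf'
  have hpos : ∀ t, 0 ≤ t → 0 < 1 + (t / h) ^ α := fun t ht => by positivity
  have hcont : ContinuousOn f (Icc 0 T) := by
    refine continuousOn_const.mul (ContinuousOn.log ?_ fun t ht => (hpos t ht.1).ne')
    exact continuousOn_const.add
      ((continuousOn_id.div_const h).rpow_const fun _ _ => Or.inr hα.le)
  have hderiv : ∀ t ∈ Ioo 0 T, HasDerivAt f (f' t) t := by
    intro t ht
    have h1 : HasDerivAt (fun t : ℝ => t / h) (1 / h) t := (hasDerivAt_id t).div_const h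
    have h2 := h1.rpow_const (p := α) (Or.inl (div_pos ht.1 hh).ne')
    exact ((h2.const_add 1).log (hpos t ht.1.le).ne').const_mul (2 / α)
  have hf'nonneg : ∀ t ∈ Ioo 0 T, 0 ≤ f' t := by
    intro t ht
    have := ht.1
    have := hpos t ht.1.le
    simp only [hf']
    positivity
  have hint := intervalIntegral.integrableOn_deriv_of_nonneg hcont hderiv hf'nonneg
  have hFTC := intervalIntegral.integral_eq_sub_of_hasDerivAt_of_le hT.le hcont hderiv
    ((intervalIntegrable_iff_integrableOn_Ioc_of_le hT.le).2 hint)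
  rw [intervalIntegral.integral_of_le hT.le] at hFTC
  have hf0 : f 0 = 0 := by simp [hf, Real.zero_rpow hα.ne']
  rw [hf0, sub_zero] at hFTC
  have hnn : 0 ≤ᵐ[volume.restrict (Ioc 0 T)] f' := by
    rw [← restrict_Ioo_eq_restrict_Ioc]
    filter_upwards [self_mem_ae_restrict measurableSet_Ioo] with t ht using hf'nonneg t ht
  change _ ≤ ENNReal.ofReal (f T)
  rw [← hFTC, ofReal_integral_eq_lintegral_ofReal hint hnn]
  refine setLIntegral_mono' measurableSet_Ioc fun t ht => ENNReal.ofReal_le_ofReal ?_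
  have ht0 : 0 < t := ht.1
  have e1 : f' t = 2 * t ^ (α - 1) / (h ^ α + t ^ α) := by
    simp only [hf', Real.div_rpow ht0.le hh.le, Real.rpow_sub_one hh.ne', Real.rpow_sub_one ht0.ne']
    have := Real.rpow_pos_of_pos hh α
    have := Real.rpow_pos_of_pos ht0 α
    field_simp
  have e2 : h ^ α + t ^ α ≤ 2 * (h + t) ^ α := by
    have := Real.rpow_le_rpow hh.le (by linarith : h ≤ h + t) hα.le
    have := Real.rpow_le_rpow ht0.le (by linarith : t ≤ h + t) hα.le
    linarith
  rw [e1, Real.rpow_neg (by positivity), ← div_eq_mul_inv, div_le_div_iff₀ (by positivity)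
    (by positivity)]
  have : 0 < t ^ (α - 1) := by positivity
  nlinarith

section Cone

variable {E : Type*} [NormedAddCommGroup E] [NormedSpace ℝ E]

lemma lintegral_inv_cone_le {x a z : E} (ha : 1 / 2 ≤ ‖a‖) (ha' : ‖a‖ ≤ 3 / 2) :
    ∫⁻ t in Ioi (0 : ℝ), {t | z ∈ Metric.ball (x + t • a) (t * (1 / 4))}.indicator
      (fun t => ENNReal.ofReal t⁻¹) t ≤ 7 := by
  set r := ‖z - x‖ with hr
  have hbound : ∀ t ∈ Ioi (0 : ℝ), z ∈ Metric.ball (x + t • a) (t * (1 / 4)) →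
      t ≤ 4 * r ∧ r ≤ 7 / 4 * t := by
    intro t (ht : 0 < t) hz
    rw [mem_ball_iff_norm] at hz
    have e1 : ‖t • a‖ = t * ‖a‖ := by rw [norm_smul, Real.norm_of_nonneg ht.le]
    have e2 : z - x = (z - (x + t • a)) + t • a := by abel
    have e3 : ‖z - x‖ ≤ ‖z - (x + t • a)‖ + ‖t • a‖ := by
      conv_lhs => rw [e2]
      exact norm_add_le _ _
    have e4 : ‖t • a‖ ≤ ‖z - x‖ + ‖z - (x + t • a)‖ := by
      have : t • a = (z - x) - (z - (x + t • a)) := by abel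
      conv_lhs => rw [this]
      exact norm_sub_le _ _
    constructor <;> nlinarith
  calc _ ≤ ∫⁻ t in Ioi (0 : ℝ), (Ioc 0 (4 * r)).indicator
        (fun _ => ENNReal.ofReal (7 / (4 * r))) t := by
        refine setLIntegral_mono' measurableSet_Ioi fun t ht => ?_
        by_cases hz : z ∈ Metric.ball (x + t • a) (t * (1 / 4))
        · have ht0 : 0 < t := ht
          obtain ⟨h1, h2⟩ := hbound t ht hz
          have hr0 : 0 < r := by linarith
          rw [indicator_of_mem (s := {t | z ∈ Metric.ball (x + t • a) (t * (1 / 4))}) hz,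
            indicator_of_mem (show t ∈ Ioc 0 (4 * r) from ⟨ht0, h1⟩)]
          refine ENNReal.ofReal_le_ofReal ?_
          rw [inv_eq_one_div, div_le_div_iff₀ ht0 (by positivity)]
          linarith
        · rw [indicator_of_notMem (s := {t | z ∈ Metric.ball (x + t • a) (t * (1 / 4))}) hz]
          exact zero_le
    _ ≤ ∫⁻ t, (Ioc 0 (4 * r)).indicator (fun _ => ENNReal.ofReal (7 / (4 * r))) t :=
        setLIntegral_le_lintegral _ _
    _ ≤ 7 := by
        rw [lintegral_indicator measurableSet_Ioc, setLIntegral_const, Real.volume_Ioc, sub_zero,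
          ← ENNReal.ofReal_mul (by positivity)]
        have h7 : 7 / (4 * r) * (4 * r) ≤ 7 := by
          rcases eq_or_ne r 0 with h | h
          · simp [h]
          · exact (div_mul_cancel₀ 7 (by positivity)).le
        exact (ENNReal.ofReal_le_ofReal h7).trans (by simp)

lemma enorm_sub_le_lintegral_fderiv {u : E → ℝ} {s : Set E} (hs : IsOpen s)
    (hu : ContDiffOn ℝ 1 u s) {x b : E} {T : ℝ} (hT : 0 ≤ T)
    (hseg : ∀ t ∈ Icc 0 T, x + t • b ∈ s) :
    ‖u (x + T • b) - u x‖ₑ ≤ ∫⁻ t in Ioc 0 T, ‖fderiv ℝ u (x + t • b)‖ₑ * ‖b‖ₑ := by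
  have hline : ContDiffOn ℝ 1 (fun t : ℝ => u (x + t • b)) (Icc 0 T) :=
    hu.comp (ContDiff.contDiffOn (by fun_prop)) hseg
  have h := enorm_sub_le_lintegral_deriv_of_contDiffOn_Icc hline hT
  simp only [zero_smul, add_zero] at h
  refine h.trans ?_
  rw [restrict_Ioc_eq_restrict_Icc]
  refine setLIntegral_mono' measurableSet_Icc fun t ht => ?_
  have hd : HasFDerivAt u (fderiv ℝ u (x + t • b)) (x + t • b) :=
    ((hu.differentiableOn one_ne_zero).differentiableAt
      (hs.mem_nhds (hseg t ht))).hasFDerivAt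
  have hb : HasDerivAt (fun t : ℝ => x + t • b) b t := by
    simpa using ((hasDerivAt_id t).smul_const b).const_add x
  have hc : HasDerivAt (fun t : ℝ => u (x + t • b)) (fderiv ℝ u (x + t • b) b) t :=
    hd.comp_hasDerivAt t hb
  rw [hc.deriv]
  exact ContinuousLinearMap.le_opENorm _ _

variable [FiniteDimensional ℝ E] [MeasurableSpace E] [BorelSpace E] (μ : Measure E) [μ.IsAddHaarMeasure]

lemma setLIntegral_ball_comp_add_smul {G : E → ℝ≥0∞} (hG : Measurable G) (x a : E) {t r : ℝ}
    (ht : 0 < t) :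
    ∫⁻ w in Metric.ball 0 r, G (x + t • (a + w)) ∂μ =
      ENNReal.ofReal ((t ^ Module.finrank ℝ E)⁻¹) *
        ∫⁻ z in Metric.ball (x + t • a) (t * r), G z ∂μ := by
  have hmeas : Measurable ((Metric.ball (x + t • a) (t * r)).indicator G) :=
    hG.indicator Metric.isOpen_ball.measurableSet
  rw [← lintegral_indicator Metric.isOpen_ball.measurableSet,
    ← lintegral_indicator Metric.isOpen_ball.measurableSet,
    ← lintegral_add_left_eq_self ((Metric.ball (x + t • a) (t * r)).indicator G) (x + t • a)]
  have key := congrArg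
    (fun ν => ∫⁻ z, (Metric.ball (x + t • a) (t * r)).indicator G (x + t • a + z) ∂ν)
    (Measure.map_addHaar_smul μ ht.ne')
  rw [lintegral_map (by fun_prop) (by fun_prop), lintegral_smul_measure, smul_eq_mul,
    abs_of_pos (by positivity)] at key
  rw [← key]
  refine lintegral_congr fun w => ?_
  have hiff : x + t • a + t • w ∈ Metric.ball (x + t • a) (t * r) ↔ w ∈ Metric.ball 0 r := by
    simp [norm_smul, abs_of_pos ht, ht]
  by_cases hw : w ∈ Metric.ball 0 r
  · rw [indicator_of_mem hw, indicator_of_mem (hiff.2 hw), smul_add, add_assoc]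
  · rw [indicator_of_notMem hw, indicator_of_notMem (mt hiff.1 hw)]

/-- Integrating over a cone in polar-type coordinates `x + t • (a + w)` is controlled by the
integral over the whole space. -/
lemma lintegral_cone_le {G : E → ℝ≥0∞} (hG : Measurable G) {x a : E} (ha : 1 / 2 ≤ ‖a‖)
    (ha' : ‖a‖ ≤ 3 / 2) :
    ∫⁻ t in Ioi (0 : ℝ), ENNReal.ofReal (t ^ ((Module.finrank ℝ E : ℝ) - 1)) *
      ∫⁻ w in Metric.ball 0 (1 / 4), G (x + t • (a + w)) ∂μ ≤ 7 * ∫⁻ z, G z ∂μ := by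
  set S : Set (ℝ × E) := {q | q.2 ∈ Metric.ball (x + q.1 • a) (q.1 * (1 / 4))} with hS
  have hSm : MeasurableSet S := by
    have : IsOpen S := by
      simp only [hS, Metric.mem_ball]
      exact isOpen_lt (by fun_prop) (by fun_prop)
    exact this.measurableSet
  set H : ℝ → E → ℝ≥0∞ := fun t z => S.indicator (fun q => ENNReal.ofReal q.1⁻¹ * G q.2) (t, z)
    with hH
  have hHm : Measurable (Function.uncurry H) := by
    change Measurable (S.indicator (fun q => ENNReal.ofReal q.1⁻¹ * G q.2))
    exact Measurable.indicator (by fun_prop) hSm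
  calc _ = ∫⁻ t in Ioi (0 : ℝ), ∫⁻ z, H t z ∂μ := by
        refine setLIntegral_congr_fun measurableSet_Ioi fun t (ht : 0 < t) => ?_
        rw [setLIntegral_ball_comp_add_smul μ hG x a ht, ← mul_assoc,
          ← ENNReal.ofReal_mul (by positivity), Real.rpow_sub_one ht.ne', Real.rpow_natCast]
        have : t ^ Module.finrank ℝ E / t * (t ^ Module.finrank ℝ E)⁻¹ = t⁻¹ := by
          field_simp
        rw [this, ← lintegral_const_mul _ hG,
          ← lintegral_indicator Metric.isOpen_ball.measurableSet]
        rfl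
    _ = ∫⁻ z, (∫⁻ t in Ioi (0 : ℝ), H t z) ∂μ := lintegral_lintegral_swap hHm.aemeasurable
    _ ≤ ∫⁻ z, 7 * G z ∂μ := by
        refine lintegral_mono fun z => ?_
        have hz : ∀ t, H t z = {t | z ∈ Metric.ball (x + t • a) (t * (1 / 4))}.indicator
            (fun t => ENNReal.ofReal t⁻¹) t * G z := by
          intro t
          by_cases h : z ∈ Metric.ball (x + t • a) (t * (1 / 4))
          · simp only [hH]
            rw [indicator_of_mem (show (t, z) ∈ S from h),
              indicator_of_mem (show t ∈ {t | z ∈ Metric.ball (x + t • a) (t * (1 / 4))} from h)]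
          · simp only [hH]
            rw [indicator_of_notMem (show (t, z) ∉ S from h), indicator_of_notMem
              (show t ∉ {t | z ∈ Metric.ball (x + t • a) (t * (1 / 4))} from h), zero_mul]
        simp_rw [hz]
        have hm : MeasurableSet {t : ℝ | z ∈ Metric.ball (x + t • a) (t * (1 / 4))} :=
          hSm.preimage (by fun_prop : Measurable fun t : ℝ => (t, z))
        rw [lintegral_mul_const _ (Measurable.indicator (by fun_prop) hm)]
        gcongr
        exact lintegral_inv_cone_le ha ha'
    _ = 7 * ∫⁻ z, G z ∂μ := lintegral_const_mul _ hG

end Cone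

section LastCoord

variable {n : ℕ}

lemma lastCoord_add (x y : EuclideanSpace ℝ (Fin n)) :
    lastCoord n (x + y) = lastCoord n x + lastCoord n y := by
  unfold lastCoord; split_ifs <;> simp

lemma lastCoord_smul (c : ℝ) (x : EuclideanSpace ℝ (Fin n)) :
    lastCoord n (c • x) = c * lastCoord n x := by
  unfold lastCoord; split_ifs <;> simp

lemma abs_lastCoord_le_norm (x : EuclideanSpace ℝ (Fin n)) : |lastCoord n x| ≤ ‖x‖ := by
  unfold lastCoord
  split_ifs with h
  · simpa using PiLp.norm_apply_le x ⟨n - 1, Nat.sub_lt h one_pos⟩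
  · simp

@[fun_prop]
lemma continuous_lastCoord : Continuous (lastCoord n) := by
  unfold lastCoord
  split_ifs <;> fun_prop

@[fun_prop]
lemma measurable_lastCoord : Measurable (lastCoord n) := continuous_lastCoord.measurable

lemma isOpen_upperHalf : IsOpen (upperHalf n) := isOpen_lt continuous_const continuous_lastCoord

lemma exists_norm_eq_one_lastCoord_eq_one (hn : 1 ≤ n) :
    ∃ e : EuclideanSpace ℝ (Fin n), ‖e‖ = 1 ∧ lastCoord n e = 1 := by
  refine ⟨EuclideanSpace.single ⟨n - 1, Nat.sub_lt hn one_pos⟩ 1, by simp, ?_⟩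
  rw [lastCoord, dif_pos (Nat.lt_of_succ_le hn)]
  simp

end LastCoord

section ConeEstimate

variable {n : ℕ} {x a : EuclideanSpace ℝ (Fin n)}

lemma le_lastCoord_cone (hx : 0 ≤ lastCoord n x) (ha : 1 / 2 ≤ lastCoord n a)
    {w : EuclideanSpace ℝ (Fin n)} (hw : w ∈ Metric.ball 0 (1 / 4)) {t : ℝ} (ht : 0 ≤ t) :
    (lastCoord n x + t) / 4 ≤ lastCoord n (x + t • (a + w)) := by
  rw [mem_ball_zero_iff] at hw
  have := neg_abs_le (lastCoord n w)
  have := abs_lastCoord_le_norm w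
  rw [lastCoord_add, lastCoord_smul, lastCoord_add]
  nlinarith

lemma energy_eq_lintegral_indicator (γ : ℝ) {p : ℝ} (hp : 0 ≤ p)
    (u : EuclideanSpace ℝ (Fin n) → ℝ) :
    energy n γ p u = ∫⁻ z, (upperHalf n).indicator
      (fun z => ‖fderiv ℝ u z‖ₑ ^ p * ENNReal.ofReal (lastCoord n z ^ γ)) z := by
  rw [energy, lintegral_indicator isOpen_upperHalf.measurableSet]
  refine lintegral_congr fun z => ?_
  rw [ENNReal.ofReal_mul (by positivity), ← ENNReal.ofReal_rpow_of_nonneg (norm_nonneg _) hp,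
    ofReal_norm]

/-- The weighted `L^p` norm of the gradient over the cone with vertex `x` is controlled by the
energy. -/
lemma lintegral_cone_gradient_le {p γ T : ℝ} (hp : 0 ≤ p) (hγ : 0 ≤ γ)
    (u : EuclideanSpace ℝ (Fin n) → ℝ) (hx : 0 < lastCoord n x) (ha : 1 / 2 ≤ lastCoord n a)
    (ha' : ‖a‖ ≤ 3 / 2) :
    ∫⁻ t in Ioc 0 T, ∫⁻ w in Metric.ball 0 (1 / 4), ‖fderiv ℝ u (x + t • (a + w))‖ₑ ^ p *
      ENNReal.ofReal (t ^ ((n : ℝ) - 1) * (lastCoord n x + t) ^ γ) ≤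
    ENNReal.ofReal (4 ^ γ) * (7 * energy n γ p u) := by
  set G : EuclideanSpace ℝ (Fin n) → ℝ≥0∞ := (upperHalf n).indicator
      (fun z => ‖fderiv ℝ u z‖ₑ ^ p * ENNReal.ofReal (lastCoord n z ^ γ)) with hG
  have hGm : Measurable G := by
    refine Measurable.indicator ?_ isOpen_upperHalf.measurableSet
    have := measurable_fderiv ℝ u
    fun_prop
  have hcone := lintegral_cone_le volume hGm (x := x)
    ((ha.trans (le_abs_self _)).trans (abs_lastCoord_le_norm a)) ha'
  rw [finrank_euclideanSpace_fin] at hcone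
  rw [energy_eq_lintegral_indicator γ hp]
  refine le_trans ?_ (mul_le_mul_right hcone _)
  rw [← lintegral_const_mul' _ _ ENNReal.ofReal_ne_top]
  refine (setLIntegral_mono' measurableSet_Ioc fun t ht => ?_).trans
    (lintegral_mono_set Ioc_subset_Ioi_self)
  have ht0 : 0 < t := ht.1
  rw [← lintegral_const_mul' _ _ ENNReal.ofReal_ne_top,
    ← lintegral_const_mul' _ _ ENNReal.ofReal_ne_top]
  refine setLIntegral_mono' Metric.isOpen_ball.measurableSet fun w hw => ?_
  have hle := le_lastCoord_cone hx.le ha hw ht0.le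
  have hz : x + t • (a + w) ∈ upperHalf n := lt_of_lt_of_le (by positivity) hle
  have hz0 : 0 < lastCoord n (x + t • (a + w)) := hz
  have hpow : (lastCoord n x + t) ^ γ ≤ 4 ^ γ * lastCoord n (x + t • (a + w)) ^ γ := by
    rw [← Real.mul_rpow (by norm_num) hz0.le]
    exact Real.rpow_le_rpow (by positivity) (by linarith) hγ
  rw [hG, indicator_of_mem hz]
  calc _ ≤ ‖fderiv ℝ u (x + t • (a + w))‖ₑ ^ p * ENNReal.ofReal
        (t ^ ((n : ℝ) - 1) * (4 ^ γ * lastCoord n (x + t • (a + w)) ^ γ)) := by gcongr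
    _ = _ := by
        rw [ENNReal.ofReal_mul (by positivity), ENNReal.ofReal_mul (by positivity)]
        ring

/-- The mean oscillation of `u` between a point and a ball at distance comparable to `T`. -/
lemma lintegral_enorm_sub_cone_le {p q T : ℝ} (hnp : (n : ℝ) < p)
    (hpq : p.HolderConjugate q) {u : EuclideanSpace ℝ (Fin n) → ℝ}
    (hu : ContDiffOn ℝ 1 u (upperHalf n)) (hT : 0 < T)
    (hx : 0 < lastCoord n x) (ha : 1 / 2 ≤ lastCoord n a) (ha' : ‖a‖ ≤ 3 / 2) :
    ∫⁻ w in Metric.ball 0 (1 / 4), ‖u (x + T • (a + w)) - u x‖ₑ ≤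
      2 * ((ENNReal.ofReal (4 ^ (p - n)) * (7 * energy n (p - n) p u)) ^ (1 / p) *
        (volume (Metric.ball (0 : EuclideanSpace ℝ (Fin n)) (1 / 4)) *
          ENNReal.ofReal (2 / ((p - n) / (p - 1)) *
            Real.log (1 + (T / lastCoord n x) ^ ((p - n) / (p - 1))))) ^ (1 / q)) := by
  set h := lastCoord n x with hh
  set B := Metric.ball (0 : EuclideanSpace ℝ (Fin n)) (1 / 4) with hB
  have hBm : MeasurableSet B := Metric.isOpen_ball.measurableSet
  have hp1 : 1 < p := hpq.lt
  have hp0 : 0 < p := by linarith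
  have hq0 : 0 < q := hpq.symm.pos
  set ω : ℝ → ℝ := fun t => t ^ ((n : ℝ) - 1) * (h + t) ^ (p - n) with hω
  have hω0 : ∀ t, 0 < t → 0 < ω t := fun t ht => by simp only [hω]; positivity
  set φ : ℝ → ℝ≥0∞ := fun t => ENNReal.ofReal (ω t ^ (1 / p)) with hφ
  set ψ : ℝ → ℝ≥0∞ := fun t => ENNReal.ofReal (ω t ^ (-(1 / p))) with hψ
  have hφm : Measurable φ := by simp only [hφ, hω]; fun_prop
  have hψm : Measurable ψ := by simp only [hψ, hω]; fun_prop
  set g : EuclideanSpace ℝ (Fin n) × ℝ → ℝ≥0∞ :=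
    fun z => ‖fderiv ℝ u (x + z.2 • (a + z.1))‖ₑ with hg
  have hgm : Measurable g := by
    have := measurable_fderiv ℝ u
    have h2 : Measurable fun z : EuclideanSpace ℝ (Fin n) × ℝ => x + z.2 • (a + z.1) := by fun_prop
    exact (this.comp h2).enorm
  set ν := ((volume : Measure (EuclideanSpace ℝ (Fin n))).restrict B).prod
    ((volume : Measure ℝ).restrict (Ioc 0 T)) with hν
  have hF : Measurable fun z : EuclideanSpace ℝ (Fin n) × ℝ => g z * φ z.2 := by fun_prop
  have hK : Measurable fun z : EuclideanSpace ℝ (Fin n) × ℝ => ψ z.2 := by fun_prop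
  have hline : ∫⁻ w in B, ‖u (x + T • (a + w)) - u x‖ₑ ≤
      2 * ∫⁻ z, ((fun z : EuclideanSpace ℝ (Fin n) × ℝ => g z * φ z.2) *
        fun z : EuclideanSpace ℝ (Fin n) × ℝ => ψ z.2) z ∂ν := by
    rw [hν, lintegral_prod _ (hF.mul hK).aemeasurable,
      ← lintegral_const_mul' _ _ ENNReal.ofNat_ne_top]
    refine setLIntegral_mono' hBm fun w hw => ?_
    have hseg : ∀ t ∈ Icc 0 T, x + t • (a + w) ∈ upperHalf n := fun t ht =>
      lt_of_lt_of_le (by have := ht.1; positivity) (le_lastCoord_cone hx.le ha hw ht.1)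
    refine (enorm_sub_le_lintegral_fderiv isOpen_upperHalf hu hT.le hseg).trans ?_
    rw [← lintegral_const_mul' _ _ ENNReal.ofNat_ne_top]
    refine setLIntegral_mono' measurableSet_Ioc fun t ht => ?_
    have hone : φ t * ψ t = 1 := by
      simp only [hφ, hψ]
      rw [← ENNReal.ofReal_mul (Real.rpow_nonneg (hω0 t ht.1).le _),
        ← Real.rpow_add (hω0 t ht.1)]
      simp
    have hnorm : ‖a + w‖ₑ ≤ 2 := by
      have h1 : ‖a + w‖ ≤ 2 := by
        have h2 := norm_add_le a w
        have h3 := mem_ball_zero_iff.1 hw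
        linarith
      rw [← ofReal_norm]
      exact (ENNReal.ofReal_le_ofReal h1).trans (by simp)
    simp only [Pi.mul_apply, hg]
    rw [mul_assoc, hone, mul_one, mul_comm]
    gcongr
  have hholder := ENNReal.lintegral_mul_le_Lp_mul_Lq ν hpq hF.aemeasurable hK.aemeasurable
  refine hline.trans (mul_le_mul_right (hholder.trans ?_) _)
  gcongr ?_ ^ _ * ?_ ^ _
  · rw [hν, lintegral_prod_symm _ (hF.pow_const p).aemeasurable]
    refine le_trans (le_of_eq ?_)
      (lintegral_cone_gradient_le (T := T) hp0.le (sub_nonneg.2 hnp.le) u hx ha ha')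
    refine setLIntegral_congr_fun measurableSet_Ioc fun t ht => lintegral_congr fun w => ?_
    simp only [hg, hφ]
    rw [ENNReal.mul_rpow_of_nonneg _ _ hp0.le,
      ENNReal.ofReal_rpow_of_nonneg (Real.rpow_nonneg (hω0 t ht.1).le _) hp0.le,
      ← Real.rpow_mul (hω0 t ht.1).le, one_div_mul_cancel hp0.ne', Real.rpow_one]
  · rw [hν, lintegral_prod _ (hK.pow_const q).aemeasurable]
    dsimp only
    rw [lintegral_const, Measure.restrict_apply_univ, mul_comm]
    refine mul_le_mul_right (le_trans (le_of_eq ?_) (lintegral_rpow_mul_add_rpow_le_log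
      (div_pos (sub_pos.2 hnp) (sub_pos.2 hp1)) hx hT)) _
    refine setLIntegral_congr_fun measurableSet_Ioc fun t ht => ?_
    have ht0 : 0 < t := ht.1
    simp only [hψ]
    rw [ENNReal.ofReal_rpow_of_nonneg (Real.rpow_nonneg (hω0 t ht0).le _) hq0.le,
      ← Real.rpow_mul (hω0 t ht0).le]
    simp only [hω]
    have hp1' : p - 1 ≠ 0 := by linarith
    rw [Real.mul_rpow (by positivity) (by positivity), ← Real.rpow_mul ht0.le,
      ← Real.rpow_mul (by positivity), hpq.conjugate_eq]
    congr 3 <;> field_simp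
    ring

end ConeEstimate

/-- Weighted Morrey–Sobolev inequality on the half-space, case `γ = p - n`. -/
theorem weighted_morrey_sobolev_eq (n : ℕ) (hn : 1 ≤ n) (p : ℝ) (hnp : (n : ℝ) < p) :
    ∃ C : ℝ, 0 < C ∧
      ∀ u : EuclideanSpace ℝ (Fin n) → ℝ,
        ContDiffOn ℝ 1 u (upperHalf n) →
        energy n (p - n) p u < ⊤ →
        ∀ x ∈ upperHalf n, ∀ y ∈ upperHalf n,
          |u x - u y| ≤
            C * (Real.log (1 + (‖x - y‖ / min (lastCoord n x) (lastCoord n y)) ^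
                  ((p - n) / (p - 1)))) ^ (1 - 1 / p) *
              (energy n (p - n) p u).toReal ^ (1 / p) := by
  have hn' : (1 : ℝ) ≤ n := by exact_mod_cast hn
  have hp1 : 1 < p := by linarith
  set q := p / (p - 1) with hq
  have hpq : p.HolderConjugate q := Real.HolderConjugate.conjExponent hp1
  have hq1 : 1 / q = 1 - 1 / p := by simpa using hpq.one_sub_inv.symm
  set α := (p - n) / (p - 1) with hα
  have hα0 : 0 < α := div_pos (by linarith) (by linarith)
  set V := volume (Metric.ball (0 : EuclideanSpace ℝ (Fin n)) (1 / 4)) with hV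
  have hVtop : V ≠ ⊤ := measure_ball_lt_top.ne
  set v := V.toReal with hv
  have hv0 : 0 < v := ENNReal.toReal_pos (Metric.measure_ball_pos _ _ (by norm_num)).ne' hVtop
  refine ⟨4 * (4 ^ (p - n) * 7) ^ (1 / p) * (v * (2 / α)) ^ (1 / q) / v, by positivity, ?_⟩
  intro u hu hE x hx y hy
  have hx0 : 0 < lastCoord n x := hx
  have hy0 : 0 < lastCoord n y := hy
  set T := ‖x - y‖ with hT
  set L := Real.log (1 + (T / min (lastCoord n x) (lastCoord n y)) ^ α) with hL
  set m := min (lastCoord n x) (lastCoord n y) with hm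
  have hm0 : 0 < m := lt_min hx0 hy0
  have hL0 : 0 ≤ L := Real.log_nonneg 
    (le_add_of_nonneg_right (Real.rpow_nonneg (div_nonneg (norm_nonneg _) hm0.le) _))
  rcases eq_or_ne x y with rfl | hxy
  · rw [sub_self, abs_zero]
    positivity
  have hT0 : 0 < T := norm_pos_iff.2 (sub_ne_zero.2 hxy)
  obtain ⟨e, he, he1⟩ := exists_norm_eq_one_lastCoord_eq_one hn
  set b : EuclideanSpace ℝ (Fin n) := (1 / (2 * T)) • (y - x) with hb
  have hbnorm : ‖b‖ = 1 / 2 := by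
    rw [hb, norm_smul, norm_sub_rev, ← hT, Real.norm_of_nonneg (by positivity)]
    field_simp
  have hvert : ∀ c : EuclideanSpace ℝ (Fin n), ‖c‖ = 1 / 2 → 1 / 2 ≤ lastCoord n (e + c) := by
    intro c hc
    have := neg_abs_le (lastCoord n c)
    have := abs_lastCoord_le_norm c
    rw [lastCoord_add, he1]
    linarith
  have hcone : ∀ z : EuclideanSpace ℝ (Fin n), m ≤ lastCoord n z →
      ∀ c : EuclideanSpace ℝ (Fin n), ‖c‖ = 1 / 2 →
      ∫⁻ w in Metric.ball 0 (1 / 4), ‖u (z + T • (e + c + w)) - u z‖ₑ ≤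
        2 * ENNReal.ofReal ((4 ^ (p - n) * (7 * (energy n (p - n) p u).toReal)) ^ (1 / p) *
          (v * (2 / α * L)) ^ (1 / q)) := by
    intro z hz c hc
    have hz0 : 0 < lastCoord n z := hm0.trans_le hz
    have ha := hvert c hc
    have ha' : ‖e + c‖ ≤ 3 / 2 := (norm_add_le e c).trans (by rw [he, hc]; norm_num)
    refine (lintegral_enorm_sub_cone_le hnp hpq hu hT0 hz0 ha ha').trans ?_
    have hlog : Real.log (1 + (T / lastCoord n z) ^ α) ≤ L := by
      apply Real.log_le_log (by positivity)
      gcongr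
    have hA : ENNReal.ofReal ((4 ^ (p - n) * (7 * (energy n (p - n) p u).toReal)) ^ (1 / p)) =
        (ENNReal.ofReal (4 ^ (p - n)) * (7 * energy n (p - n) p u)) ^ (1 / p) := by
      rw [← ENNReal.ofReal_rpow_of_nonneg (by positivity) (by positivity),
        ENNReal.ofReal_mul (by positivity), ENNReal.ofReal_mul (by positivity),
        ENNReal.ofReal_toReal hE.ne, ENNReal.ofReal_ofNat]
    have hD : ENNReal.ofReal ((v * (2 / α * L)) ^ (1 / q)) =
        (V * ENNReal.ofReal (2 / α * L)) ^ (1 / q) := by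
      rw [← ENNReal.ofReal_rpow_of_nonneg (by positivity) hpq.symm.one_div_nonneg,
        ENNReal.ofReal_mul hv0.le, hv, ENNReal.ofReal_toReal hVtop]
    rw [ENNReal.ofReal_mul (p := (_ * (7 * _)) ^ (1 / p)) (by positivity), hA, hD]
    have hq0 := hpq.symm.one_div_nonneg
    gcongr
  have hX := hcone x (min_le_left _ _) b hbnorm
  have hY := hcone y (min_le_right _ _) (-b) (by rw [norm_neg, hbnorm])
  have hshift : ∀ w, y + T • (e + -b + w) = x + T • (e + b + w) := by
    intro w
    have : T • b + T • b = y - x := by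
      rw [← two_smul ℝ, hb, smul_smul, smul_smul]
      convert one_smul ℝ (y - x) using 2
      field_simp
    rw [eq_comm, ← sub_eq_zero]
    calc _ = (T • b + T • b) - (y - x) := by simp only [smul_add, smul_neg]; abel
      _ = 0 := by rw [this, sub_self]
  simp only [hshift] at hY
  set R := (4 ^ (p - n) * (7 * (energy n (p - n) p u).toReal)) ^ (1 / p) *
    (v * (2 / α * L)) ^ (1 / q) with hR
  have hR0 : 0 ≤ R := by positivity
  have hucont : ContinuousOn u (upperHalf n) := hu.continuousOn
  have hmeas : AEMeasurable (fun w => ‖u (x + T • (e + b + w)) - u x‖ₑ)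
      (volume.restrict (Metric.ball 0 (1 / 4))) := by
    refine ContinuousOn.aemeasurable ?_ Metric.isOpen_ball.measurableSet
    refine ((hucont.comp (by fun_prop) fun w hw => ?_).sub continuousOn_const).enorm
    exact lt_of_lt_of_le (by positivity) (le_lastCoord_cone hx0.le (hvert b hbnorm) hw hT0.le)
  have hsum : ENNReal.ofReal |u x - u y| * V ≤ ENNReal.ofReal (4 * R) := by
    calc ENNReal.ofReal |u x - u y| * V
        = ∫⁻ _ in Metric.ball (0 : EuclideanSpace ℝ (Fin n)) (1 / 4),
            ENNReal.ofReal |u x - u y| := (setLIntegral_const _ _).symm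
      _ ≤ ∫⁻ w in Metric.ball 0 (1 / 4), (‖u (x + T • (e + b + w)) - u x‖ₑ +
            ‖u (x + T • (e + b + w)) - u y‖ₑ) := by
          refine lintegral_mono fun w => ?_
          rw [← Real.norm_eq_abs, ofReal_norm, ← edist_eq_enorm_sub, ← edist_eq_enorm_sub,
            ← edist_eq_enorm_sub]
          exact edist_triangle_left _ _ _
      _ ≤ 2 * ENNReal.ofReal R + 2 * ENNReal.ofReal R := by
          rw [lintegral_add_left' hmeas]
          exact add_le_add hX hY
      _ = ENNReal.ofReal (4 * R) := by
          rw [ENNReal.ofReal_mul (p := 4) (by norm_num), ENNReal.ofReal_ofNat, ← add_mul]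
          norm_num
  rw [← ENNReal.ofReal_toReal hVtop, ← hv, ← ENNReal.ofReal_mul (abs_nonneg _),
    ENNReal.ofReal_le_ofReal_iff (by positivity)] at hsum
  rw [← hq1]
  calc |u x - u y| ≤ 4 * R / v := (le_div_iff₀ hv0).2 hsum
    _ = _ := by
        rw [hR, ← mul_assoc (4 ^ (p - n)), ← mul_assoc v,
          Real.mul_rpow (x := 4 ^ (p - n) * 7) (by positivity) (by positivity),
          Real.mul_rpow (x := v * (2 / α)) (by positivity) hL0]
        ring
end
end

section
/- Let n ≥ 1, γ ∈ ℝ with γ ≤ −1, and n < p < +∞. There exists a constant C > 0, depending only on n, γ and p, such that every function u : ℝⁿ → ℝ that is continuous on the closed half-space ℝⁿ⁻¹ × [0, +∞), continuously differentiable on ℝⁿ₊, and has finite weighted energy E_γ(u) < +∞, satisfies, for all x, y ∈ ℝⁿ₊, |u(x) − u(y)| ≤ C · max(xₙ, yₙ)^{1 − (n+γ)/p} · |x − y|^{1 − n/p} / max(xₙ, yₙ, |x − y|)^{1 − n/p} · E_γ(u)^{1/p}. -/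
open MeasureTheory Real Set
open scoped ENNReal

noncomputable section

section Auxiliary

variable {E : Type*} [NormedAddCommGroup E] [NormedSpace ℝ E]

/-- The oscillation of a `C¹` function between two points of an open convex set is at most the
integral of its derivative along the segment. -/
theorem enorm_sub_le_lintegral_fderiv_segment {U : Set E} (hU : IsOpen U) (hconv : Convex ℝ U)
    {u : E → ℝ} (hu : ContDiffOn ℝ 1 u U) {x y : E} (hx : x ∈ U) (hy : y ∈ U) :
    ‖u y - u x‖ₑ ≤ ∫⁻ s in Ioc (0 : ℝ) 1, ‖fderiv ℝ u (x + s • (y - x))‖ₑ * ‖y - x‖ₑ := by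
  have hmem : ∀ s ∈ Icc (0 : ℝ) 1, x + s • (y - x) ∈ U := fun s hs =>
    hconv.add_smul_sub_mem hx hy hs
  have hline : ContDiff ℝ 1 (fun s : ℝ => x + s • (y - x)) := by fun_prop
  have h := enorm_sub_le_lintegral_deriv_of_contDiffOn_Icc
    (f := fun s : ℝ => u (x + s • (y - x))) (a := 0) (b := 1)
    (hu.comp hline.contDiffOn hmem) zero_le_one
  simp only [one_smul, add_sub_cancel, zero_smul, add_zero] at h
  rw [← restrict_Ioc_eq_restrict_Icc] at h
  refine h.trans (setLIntegral_mono' measurableSet_Ioc fun s hs => ?_)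
  have hd : HasDerivAt (fun s : ℝ => x + s • (y - x)) (y - x) s := by
    simpa using ((hasDerivAt_id s).smul_const (y - x)).const_add x
  have hfd : HasFDerivAt u (fderiv ℝ u (x + s • (y - x))) (x + s • (y - x)) :=
    ((hu.contDiffAt (hU.mem_nhds (hmem s (Ioc_subset_Icc_self hs)))).differentiableAt
      one_ne_zero).hasFDerivAt
  have hderiv := (hfd.comp_hasDerivAt s hd).deriv
  rw [Function.comp_def] at hderiv
  rw [hderiv]
  exact (fderiv ℝ u (x + s • (y - x))).le_opENorm (y - x)

theorem lintegral_le_rpow_mul_measure_univ {α : Type*} [MeasurableSpace α] (μ : Measure α)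
    {f : α → ℝ≥0∞} (hf : AEMeasurable f μ) {p : ℝ} (hp : 1 < p) :
    ∫⁻ a, f a ∂μ ≤ (∫⁻ a, f a ^ p ∂μ) ^ (1 / p) * μ univ ^ (1 - 1 / p) := by
  have h := ENNReal.lintegral_mul_le_Lp_mul_Lq μ (Real.HolderConjugate.conjExponent hp) hf
    (aemeasurable_const (b := (1 : ℝ≥0∞)))
  have hq : 1 / p.conjExponent = 1 - 1 / p := by
    have := (Real.HolderConjugate.conjExponent hp).inv_add_inv_eq_one
    simp only [one_div]
    linarith
  simpa [hq] using h

variable [FiniteDimensional ℝ E] [MeasurableSpace E] [BorelSpace E]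

theorem lintegral_comp_homothety (μ : Measure E) [μ.IsAddHaarMeasure] {f : E → ℝ≥0∞}
    (hf : Measurable f) (x : E) {s : ℝ} (hs : 0 < s) :
    ∫⁻ z, f (x + s • (z - x)) ∂μ =
      ENNReal.ofReal (s ^ (-(Module.finrank ℝ E : ℝ))) * ∫⁻ z, f z ∂μ := by
  have h1 : ∫⁻ z, f (x + s • (z - x)) ∂μ = ∫⁻ z, f (x + s • z) ∂μ :=
    lintegral_sub_right_eq_self (fun z => f (x + s • z)) x
  have h2 : ∫⁻ z, f (x + s • z) ∂μ = ∫⁻ z, f (x + z) ∂(Measure.map (s • ·) μ) :=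
    (lintegral_map (f := fun z => f (x + z)) (by fun_prop) (by fun_prop)).symm
  rw [h1, h2, Measure.map_addHaar_smul μ hs.ne', lintegral_smul_measure,
    lintegral_add_left_eq_self f x, smul_eq_mul, Real.rpow_neg hs.le, Real.rpow_natCast,
    abs_of_pos (by positivity)]

theorem lintegral_enorm_sub_ball_le (μ : Measure E) [μ.IsAddHaarMeasure] {u : E → ℝ} {c x : E}
    {R p : ℝ} (hp : 1 < p) (hu : ContDiffOn ℝ 1 u (Metric.ball c R)) (hx : x ∈ Metric.ball c R) :
    ∫⁻ z in Metric.ball c R, ‖u z - u x‖ₑ ∂μ ≤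
      (∫⁻ s in Ioc (0 : ℝ) 1, ENNReal.ofReal (s ^ (-(Module.finrank ℝ E : ℝ) / p))) *
        ((∫⁻ z in Metric.ball c R, ‖fderiv ℝ u z‖ₑ ^ p ∂μ) ^ (1 / p) *
          μ (Metric.ball c R) ^ (1 - 1 / p) * ENNReal.ofReal (2 * R)) := by
  have hp0 : 0 < p := by linarith
  set B := Metric.ball c R with hB
  have hBm : MeasurableSet B := Metric.isOpen_ball.measurableSet
  set f : E → ℝ≥0∞ := B.indicator fun z => ‖fderiv ℝ u z‖ₑ with hf
  have hfm : Measurable f := (measurable_fderiv ℝ u).enorm.indicator hBm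
  have hfp : ∫⁻ z, f z ^ p ∂μ = ∫⁻ z in B, ‖fderiv ℝ u z‖ₑ ^ p ∂μ := by
    rw [← lintegral_indicator hBm]
    refine lintegral_congr fun z => ?_
    by_cases hz : z ∈ B <;> simp [hf, hz, hp0]
  calc
    ∫⁻ z in B, ‖u z - u x‖ₑ ∂μ
      ≤ ∫⁻ z in B, (∫⁻ s in Ioc (0 : ℝ) 1, f (x + s • (z - x)) *
          ENNReal.ofReal (2 * R)) ∂μ := by
        refine setLIntegral_mono' hBm fun z hz => ?_
        refine (enorm_sub_le_lintegral_fderiv_segment Metric.isOpen_ball (convex_ball c R)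
          hu hx hz).trans (setLIntegral_mono' measurableSet_Ioc fun s hs => ?_)
        have hmem : x + s • (z - x) ∈ B :=
          (convex_ball c R).add_smul_sub_mem hx hz (Ioc_subset_Icc_self hs)
        rw [hf, indicator_of_mem hmem]
        gcongr
        rw [← ofReal_norm]
        refine ENNReal.ofReal_le_ofReal ?_
        rw [← dist_eq_norm]
        have h1 := Metric.mem_ball.1 hx
        have h2 := Metric.mem_ball.1 hz
        have h3 := dist_triangle_right z x c
        linarith
    _ = ∫⁻ s in Ioc (0 : ℝ) 1, ∫⁻ z in B, f (x + s • (z - x)) * ENNReal.ofReal (2 * R) ∂μ :=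
        lintegral_lintegral_swap (by
          apply Measurable.aemeasurable
          have : Measurable fun q : E × ℝ => x + q.2 • (q.1 - x) := by fun_prop
          exact (hfm.comp this).mul_const _)
    _ ≤ ∫⁻ s in Ioc (0 : ℝ) 1, ENNReal.ofReal (s ^ (-(Module.finrank ℝ E : ℝ) / p)) *
          ((∫⁻ z in B, ‖fderiv ℝ u z‖ₑ ^ p ∂μ) ^ (1 / p) *
          μ B ^ (1 - 1 / p) * ENNReal.ofReal (2 * R)) := by
        refine setLIntegral_mono' measurableSet_Ioc fun s hs => ?_
        have hm : Measurable fun z => f (x + s • (z - x)) := hfm.comp (by fun_prop)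
        rw [lintegral_mul_const _ hm, ← mul_assoc, ← mul_assoc]
        gcongr
        refine (lintegral_le_rpow_mul_measure_univ _ hm.aemeasurable hp).trans ?_
        rw [Measure.restrict_apply_univ]
        gcongr
        calc
          (∫⁻ z in B, f (x + s • (z - x)) ^ p ∂μ) ^ (1 / p)
            ≤ (∫⁻ z, f (x + s • (z - x)) ^ p ∂μ) ^ (1 / p) := by
              gcongr
              exact Measure.restrict_le_self
          _ = _ := by
            rw [lintegral_comp_homothety μ (f := fun z => f z ^ p) (hfm.pow_const p) x hs.1, hfp,
              ENNReal.mul_rpow_of_nonneg _ _ (by positivity),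
              ENNReal.ofReal_rpow_of_pos (Real.rpow_pos_of_pos hs.1 _), ← Real.rpow_mul hs.1.le,
              mul_one_div]
    _ = _ := lintegral_mul_const _ (by fun_prop)

/-- Morrey's inequality on a ball, in integrated form. -/
theorem measure_ball_mul_enorm_sub_le (μ : Measure E) [μ.IsAddHaarMeasure] {u : E → ℝ}
    {c x y : E} {R p : ℝ} (hp : 1 < p) (hu : ContDiffOn ℝ 1 u (Metric.ball c R))
    (hx : x ∈ Metric.ball c R) (hy : y ∈ Metric.ball c R) :
    μ (Metric.ball c R) * ‖u x - u y‖ₑ ≤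
      2 * ((∫⁻ s in Ioc (0 : ℝ) 1, ENNReal.ofReal (s ^ (-(Module.finrank ℝ E : ℝ) / p))) *
        ((∫⁻ z in Metric.ball c R, ‖fderiv ℝ u z‖ₑ ^ p ∂μ) ^ (1 / p) *
          μ (Metric.ball c R) ^ (1 - 1 / p) * ENNReal.ofReal (2 * R))) := by
  rw [mul_comm, ← setLIntegral_const]
  have hBm : MeasurableSet (Metric.ball c R) := Metric.isOpen_ball.measurableSet
  have hae : AEMeasurable (fun z => ‖u z - u x‖ₑ) (μ.restrict (Metric.ball c R)) :=
    ((hu.continuousOn.sub continuousOn_const).aemeasurable hBm).enorm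
  calc
    ∫⁻ _ in Metric.ball c R, ‖u x - u y‖ₑ ∂μ
      ≤ ∫⁻ z in Metric.ball c R, (‖u z - u x‖ₑ + ‖u z - u y‖ₑ) ∂μ := by
        refine lintegral_mono fun z => ?_
        calc ‖u x - u y‖ₑ = ‖-(u z - u x) + (u z - u y)‖ₑ := by congr 1; ring
          _ ≤ _ := (enorm_add_le _ _).trans (by rw [enorm_neg])
    _ ≤ _ := by
      rw [lintegral_add_left' hae, two_mul]
      exact add_le_add (lintegral_enorm_sub_ball_le μ hp hu hx)
        (lintegral_enorm_sub_ball_le μ hp hu hy)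

end Auxiliary

theorem lintegral_Ioo_rpow_eq_top {γ η : ℝ} (hγ : γ ≤ -1) (hη : 0 < η) :
    ∫⁻ t in Ioo 0 η, ENNReal.ofReal (t ^ γ) = ⊤ := by
  by_contra hne
  have hint : IntegrableOn (fun t : ℝ => t ^ γ) (Ioo 0 η) := by
    refine (lintegral_ofReal_ne_top_iff_integrable (by fun_prop) ?_).1 hne
    filter_upwards [self_mem_ae_restrict measurableSet_Ioo] with t ht
    exact Real.rpow_nonneg ht.1.le γ
  rw [intervalIntegral.integrableOn_Ioo_rpow_iff hη] at hint
  linarith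

section HalfSpace

variable {n : ℕ} {i : Fin n}

theorem isOpen_coord_pos (i : Fin n) : IsOpen {z : EuclideanSpace ℝ (Fin n) | 0 < z i} :=
  isOpen_lt continuous_const (by fun_prop)

theorem convex_coord_pos (i : Fin n) : Convex ℝ {z : EuclideanSpace ℝ (Fin n) | 0 < z i} :=
  convex_halfSpace_gt (EuclideanSpace.proj (𝕜 := ℝ) i).toLinearMap.isLinear 0

/-- The weight `zᵢ ^ γ` with `γ ≤ -1` is not integrable near any boundary point of `{zᵢ > 0}`. -/
theorem lintegral_coord_rpow_eq_top {γ : ℝ} (hγ : γ ≤ -1) {a : EuclideanSpace ℝ (Fin n)}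
    (ha : a i = 0) {V : Set (EuclideanSpace ℝ (Fin n))} (hV : IsOpen V) (haV : a ∈ V) :
    ∫⁻ z in V ∩ {z | 0 < z i}, ENNReal.ofReal (z i ^ γ) = ⊤ := by
  have hmp := PiLp.volume_preserving_toLp (Fin n)
  have hemb := (MeasurableEquiv.toLp 2 (Fin n → ℝ)).measurableEmbedding
  rw [← hmp.setLIntegral_comp_preimage_emb hemb]
  have hopen : IsOpen (WithLp.toLp 2 ⁻¹' V : Set (Fin n → ℝ)) :=
    hV.preimage (PiLp.continuous_toLp 2 _)
  obtain ⟨η, hη, hball⟩ := Metric.isOpen_iff.1 hopen (WithLp.ofLp a) (by simpa using haV)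
  let I : Fin n → Set ℝ := fun j => if j = i then Ioo 0 η else Ioo (a j - η) (a j + η)
  have hsub : univ.pi I ⊆ WithLp.toLp 2 ⁻¹' (V ∩ {z : EuclideanSpace ℝ (Fin n) | 0 < z i}) := by
    intro z hz
    have hzj : ∀ j, z j ∈ I j := fun j => hz j (mem_univ j)
    have hzi := hzj i
    simp only [I, if_true] at hzi
    refine ⟨hball ?_, hzi.1⟩
    rw [Metric.mem_ball, dist_pi_lt_iff hη]
    intro j
    rw [Real.dist_eq, abs_sub_lt_iff]
    have h := hzj j
    by_cases hj : j = i
    · subst hj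
      constructor <;> linarith [hzi.1, hzi.2]
    · simp only [I, if_neg hj] at h
      constructor <;> linarith [h.1, h.2]
  have hbox : ∫⁻ z in univ.pi I, ENNReal.ofReal (z i ^ γ) = ⊤ := by
    rw [volume_pi, Measure.restrict_pi_pi]
    rw [← lintegral_map (μ := Measure.pi fun j => volume.restrict (I j))
      (f := fun t : ℝ => ENNReal.ofReal (t ^ γ)) (g := Function.eval i) (by fun_prop)
      (measurable_pi_apply i), Measure.pi_map_eval, lintegral_smul_measure]
    have hIi : I i = Ioo 0 η := by simp [I]
    rw [hIi, lintegral_Ioo_rpow_eq_top hγ hη, smul_eq_mul, ENNReal.mul_top]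
    refine Finset.prod_ne_zero_iff.2 fun j hj => ?_
    have hIj : I j = Ioo (a j - η) (a j + η) := if_neg (Finset.ne_of_mem_erase hj)
    rw [Measure.restrict_apply_univ, hIj, Real.volume_Ioo]
    simp only [ne_eq, ENNReal.ofReal_eq_zero, not_le]
    linarith
  exact top_unique (hbox ▸ lintegral_mono_set hsub)

/-- The weighted `Lᵖ` norm of a horizontal increment is controlled by the weighted energy. -/
theorem lintegral_enorm_horizontal_sub_le {p γ : ℝ} (hp : 1 < p)
    {u : EuclideanSpace ℝ (Fin n) → ℝ} (hu : ContDiffOn ℝ 1 u {z | 0 < z i})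
    {v : EuclideanSpace ℝ (Fin n)} (hv : v i = 0) :
    ∫⁻ z in {z : EuclideanSpace ℝ (Fin n) | 0 < z i},
        ‖u (z + v) - u z‖ₑ ^ p * ENNReal.ofReal (z i ^ γ) ≤
      ‖v‖ₑ ^ p * ∫⁻ z in {z : EuclideanSpace ℝ (Fin n) | 0 < z i},
        ‖fderiv ℝ u z‖ₑ ^ p * ENNReal.ofReal (z i ^ γ) := by
  have hp0 : 0 < p := by linarith
  set H : Set (EuclideanSpace ℝ (Fin n)) := {z | 0 < z i} with hH
  have hHm : MeasurableSet H := (isOpen_coord_pos i).measurableSet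
  set F : EuclideanSpace ℝ (Fin n) → ℝ≥0∞ :=
    H.indicator fun z => ‖fderiv ℝ u z‖ₑ ^ p * ENNReal.ofReal (z i ^ γ) with hF
  have hFm : Measurable F := by
    refine Measurable.indicator ?_ hHm
    have h1 : Measurable fun z => ‖fderiv ℝ u z‖ₑ := (measurable_fderiv ℝ u).enorm
    fun_prop
  have hcoord : ∀ (z : EuclideanSpace ℝ (Fin n)) (s : ℝ), (z + s • v) i = z i := by
    intro z s
    simp [hv]
  calc
    ∫⁻ z in H, ‖u (z + v) - u z‖ₑ ^ p * ENNReal.ofReal (z i ^ γ)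
      ≤ ∫⁻ z in H, ∫⁻ s in Ioc (0 : ℝ) 1, F (z + s • v) * ‖v‖ₑ ^ p := by
        refine setLIntegral_mono' hHm fun z hz => ?_
        have hzv : z + v ∈ H := by simpa [hH, hv] using hz
        have hseg := enorm_sub_le_lintegral_fderiv_segment (isOpen_coord_pos i)
          (convex_coord_pos i) hu hz hzv
        simp only [add_sub_cancel_left] at hseg
        have hm : Measurable fun s : ℝ => ‖fderiv ℝ u (z + s • v)‖ₑ * ‖v‖ₑ :=
          ((measurable_fderiv ℝ u).enorm.comp
            (by fun_prop : Measurable fun s : ℝ => z + s • v)).mul_const _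
        have hhol := lintegral_le_rpow_mul_measure_univ (volume.restrict (Ioc (0 : ℝ) 1))
          hm.aemeasurable hp
        simp only [Measure.restrict_apply_univ, Real.volume_Ioc, sub_zero, ENNReal.ofReal_one,
          ENNReal.one_rpow, mul_one] at hhol
        have hpow := ENNReal.rpow_le_rpow (hseg.trans hhol) hp0.le
        rw [← ENNReal.rpow_mul, one_div_mul_cancel hp0.ne', ENNReal.rpow_one] at hpow
        calc
          ‖u (z + v) - u z‖ₑ ^ p * ENNReal.ofReal (z i ^ γ)
            ≤ (∫⁻ s in Ioc (0 : ℝ) 1, (‖fderiv ℝ u (z + s • v)‖ₑ * ‖v‖ₑ) ^ p) *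
                ENNReal.ofReal (z i ^ γ) := by gcongr
          _ = _ := by
            rw [← lintegral_mul_const _ (hm.pow_const p)]
            refine lintegral_congr fun s => ?_
            have hzs : z + s • v ∈ H := by
              rw [hH, mem_ofPred_eq, hcoord]
              exact hz
            rw [hF, indicator_of_mem hzs, hcoord, ENNReal.mul_rpow_of_nonneg _ _ hp0.le]
            ring
    _ ≤ ∫⁻ z, ∫⁻ s in Ioc (0 : ℝ) 1, F (z + s • v) * ‖v‖ₑ ^ p :=
        lintegral_mono' Measure.restrict_le_self le_rfl
    _ = ∫⁻ s in Ioc (0 : ℝ) 1, ∫⁻ z, F (z + s • v) * ‖v‖ₑ ^ p :=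
        lintegral_lintegral_swap (by
          apply Measurable.aemeasurable
          have : Measurable fun q : EuclideanSpace ℝ (Fin n) × ℝ => q.1 + q.2 • v := by fun_prop
          exact (hFm.comp this).mul_const _)
    _ = ∫⁻ _ in Ioc (0 : ℝ) 1, (∫⁻ z, F z) * ‖v‖ₑ ^ p := by
        refine lintegral_congr fun s => ?_
        have hm : Measurable fun z => F (z + s • v) := hFm.comp (by fun_prop)
        rw [lintegral_mul_const _ hm, lintegral_add_right_eq_self]
    _ = _ := by
        rw [setLIntegral_const, Real.volume_Ioc, sub_zero, ENNReal.ofReal_one, mul_one, hF,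
          lintegral_indicator hHm, mul_comm]

/-- A function of finite weighted energy with `γ ≤ -1` has constant trace on the boundary. -/
theorem eq_of_coord_eq_zero {p γ : ℝ} (hp : 1 < p) (hγ : γ ≤ -1)
    {u : EuclideanSpace ℝ (Fin n) → ℝ} (hcont : ContinuousOn u {z | 0 ≤ z i})
    (hu : ContDiffOn ℝ 1 u {z | 0 < z i})
    (hfin : ∫⁻ z in {z : EuclideanSpace ℝ (Fin n) | 0 < z i},
      ‖fderiv ℝ u z‖ₑ ^ p * ENNReal.ofReal (z i ^ γ) ≠ ⊤)
    {a b : EuclideanSpace ℝ (Fin n)} (ha : a i = 0) (hb : b i = 0) : u a = u b := by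
  have hp0 : 0 < p := by linarith
  by_contra hab
  set v := b - a with hv
  have hvi : v i = 0 := by simp [hv, ha, hb]
  have hw : ContinuousWithinAt (fun z => |u (z + v) - u z|) {z | 0 ≤ z i} a := by
    refine ContinuousWithinAt.abs (ContinuousWithinAt.sub ?_ (hcont a ha.ge))
    refine ContinuousWithinAt.comp (t := {z | 0 ≤ z i}) (hcont (a + v) ?_) (by fun_prop) ?_
    · simp [ha, hvi]
    · intro z hz
      simpa [hvi] using hz
  have hpos : 0 < |u (a + v) - u a| := by
    rw [hv, add_sub_cancel, abs_pos]
    exact sub_ne_zero.2 (Ne.symm hab)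
  have hev := hw.eventually (lt_mem_nhds (half_lt_self hpos))
  obtain ⟨V, hV, haV, hsub⟩ := mem_nhdsWithin.1 hev
  set δ := |u (a + v) - u a| / 2 with hδ
  have hδ0 : 0 < δ := half_pos hpos
  have hbound := lintegral_enorm_horizontal_sub_le (γ := γ) hp hu hvi
  have hlow : ENNReal.ofReal δ ^ p *
        ∫⁻ z in V ∩ {z | 0 < z i}, ENNReal.ofReal (z i ^ γ) ≤
      ∫⁻ z in {z : EuclideanSpace ℝ (Fin n) | 0 < z i},
        ‖u (z + v) - u z‖ₑ ^ p * ENNReal.ofReal (z i ^ γ) := by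
    rw [← lintegral_const_mul _ (by fun_prop)]
    calc
      _ ≤ ∫⁻ z in V ∩ {z | 0 < z i}, ‖u (z + v) - u z‖ₑ ^ p * ENNReal.ofReal (z i ^ γ) := by
        refine setLIntegral_mono' (hV.inter (isOpen_coord_pos i)).measurableSet fun z hz => ?_
        gcongr
        rw [Real.enorm_eq_ofReal_abs]
        have hzi : 0 < z i := hz.2
        exact ENNReal.ofReal_le_ofReal (hsub ⟨hz.1, hzi.le⟩).le
      _ ≤ _ := lintegral_mono_set inter_subset_right
  have htop := hlow.trans hbound
  rw [lintegral_coord_rpow_eq_top hγ ha hV haV, ENNReal.mul_top (by simp [hδ0])] at htop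
  exact ENNReal.mul_ne_top (ENNReal.rpow_ne_top_of_nonneg hp0.le (by simp)) hfin
    (top_unique htop)

theorem lintegral_Ioc_rpow_ne_top {r : ℝ} (hr : -1 < r) :
    ∫⁻ s in Ioc (0 : ℝ) 1, ENNReal.ofReal (s ^ r) ≠ ⊤ := by
  have hint : IntegrableOn (fun s : ℝ => s ^ r) (Ioc 0 1) :=
    (intervalIntegrable_iff_integrableOn_Ioc_of_le zero_le_one).1
      (intervalIntegral.intervalIntegrable_rpow' hr)
  refine (lintegral_ofReal_ne_top_iff_integrable (by fun_prop) ?_).2 hint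
  filter_upwards [self_mem_ae_restrict measurableSet_Ioc] with s hs
  exact Real.rpow_nonneg hs.1.le r

theorem ball_subset_coord_Ioo {x : EuclideanSpace ℝ (Fin n)} {R : ℝ} (hRx : R ≤ x i) :
    Metric.ball x R ⊆ {z | z i ∈ Ioo 0 (2 * x i)} := by
  intro z hz
  have h1 : ‖(z - x) i‖ ≤ ‖z - x‖ := PiLp.norm_apply_le _ _
  rw [Metric.mem_ball, dist_eq_norm] at hz
  have h2 := abs_lt.1 ((Real.norm_eq_abs _ ▸ h1).trans_lt hz)
  rw [PiLp.sub_apply] at h2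
  constructor <;> linarith [h2.1, h2.2]

/-- Morrey's inequality on a ball in the half-space, in terms of the weighted energy. -/
theorem exists_abs_sub_le_ball (i : Fin n) {p γ : ℝ} (hnp : (n : ℝ) < p) (hp : 1 < p)
    (hγ : γ ≤ 0) :
    ∃ C : ℝ, 0 < C ∧ ∀ u : EuclideanSpace ℝ (Fin n) → ℝ, ContDiffOn ℝ 1 u {z | 0 < z i} →
      ∫⁻ z in {z : EuclideanSpace ℝ (Fin n) | 0 < z i},
        ‖fderiv ℝ u z‖ₑ ^ p * ENNReal.ofReal (z i ^ γ) ≠ ⊤ →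
      ∀ (x y : EuclideanSpace ℝ (Fin n)) (R : ℝ), 0 < R → R ≤ x i → y ∈ Metric.ball x R →
        |u x - u y| ≤ C * R ^ (1 - (n : ℝ) / p) * x i ^ (-γ / p) *
          (∫⁻ z in {z : EuclideanSpace ℝ (Fin n) | 0 < z i},
            ‖fderiv ℝ u z‖ₑ ^ p * ENNReal.ofReal (z i ^ γ)).toReal ^ (1 / p) := by
  have hp0 : 0 < p := by linarith
  have hK := lintegral_Ioc_rpow_ne_top (r := -(n : ℝ) / p) (by
    rw [neg_div, neg_lt_neg_iff, div_lt_one hp0]; exact hnp)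
  set k := (∫⁻ s in Ioc (0 : ℝ) 1, ENNReal.ofReal (s ^ (-(n : ℝ) / p))).toReal with hk
  set w := (volume (Metric.ball (0 : EuclideanSpace ℝ (Fin n)) 1)).toReal with hw
  have hw0 : 0 < w := ENNReal.toReal_pos (Metric.measure_ball_pos _ _ one_pos).ne'
    measure_ball_lt_top.ne
  have hk0 : 0 ≤ k := ENNReal.toReal_nonneg
  refine ⟨4 * (k + 1) * w ^ (-(1 / p)) * 2 ^ (-γ / p), by positivity, ?_⟩
  intro u hu hfin x y R hR hRx hy
  set A := (∫⁻ z in {z : EuclideanSpace ℝ (Fin n) | 0 < z i},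
    ‖fderiv ℝ u z‖ₑ ^ p * ENNReal.ofReal (z i ^ γ)).toReal with hA
  have hA0 : 0 ≤ A := ENNReal.toReal_nonneg
  have hx : 0 < x i := hR.trans_le hRx
  have hsub := ball_subset_coord_Ioo (i := i) hRx
  have hsubH : Metric.ball x R ⊆ {z | 0 < z i} := fun z hz => (hsub hz).1
  have hmain := measure_ball_mul_enorm_sub_le volume hp (hu.mono hsubH)
    (Metric.mem_ball_self hR) hy
  have hI : ∫⁻ z in Metric.ball x R, ‖fderiv ℝ u z‖ₑ ^ p ≤
      ENNReal.ofReal ((2 * x i) ^ (-γ) * A) := by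
    rw [ENNReal.ofReal_mul (by positivity), hA, ENNReal.ofReal_toReal hfin]
    calc
      _ ≤ ∫⁻ z in Metric.ball x R, ENNReal.ofReal ((2 * x i) ^ (-γ)) *
            (‖fderiv ℝ u z‖ₑ ^ p * ENNReal.ofReal (z i ^ γ)) := by
        refine setLIntegral_mono' Metric.isOpen_ball.measurableSet fun z hz => ?_
        have hz' : 0 < z i ∧ z i < 2 * x i := hsub hz
        rw [mul_left_comm, ← ENNReal.ofReal_mul (by positivity)]
        refine le_mul_of_one_le_right' (ENNReal.one_le_ofReal.2 ?_)
        calc (1 : ℝ) = z i ^ (-γ) * z i ^ γ := by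
              rw [← Real.rpow_add hz'.1, neg_add_cancel, Real.rpow_zero]
          _ ≤ _ := mul_le_mul_of_nonneg_right
              (Real.rpow_le_rpow hz'.1.le hz'.2.le (by linarith)) (Real.rpow_nonneg hz'.1.le _)
      _ ≤ _ := by
        rw [lintegral_const_mul' _ _ ENNReal.ofReal_ne_top]
        gcongr
  have hball : volume (Metric.ball x R) = ENNReal.ofReal (R ^ n * w) := by
    rw [Measure.addHaar_ball_of_pos _ _ hR, finrank_euclideanSpace_fin,
      ENNReal.ofReal_mul (by positivity), hw, ENNReal.ofReal_toReal measure_ball_lt_top.ne]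
  set b := R ^ n * w with hb
  have hb0 : 0 < b := by positivity
  have hq : 0 ≤ 1 - 1 / p := by
    rw [sub_nonneg, div_le_one hp0]
    exact hp.le
  set J := (2 * x i) ^ (-γ) * A with hJ
  have hJ0 : 0 ≤ J := by positivity
  have hreal : b * |u x - u y| ≤ 2 * (k * (J ^ (1 / p) * b ^ (1 - 1 / p) * (2 * R))) := by
    rw [← ENNReal.ofReal_le_ofReal_iff (by positivity)]
    rw [finrank_euclideanSpace_fin, hball, Real.enorm_eq_ofReal_abs,
      ← ENNReal.ofReal_mul hb0.le] at hmain
    refine hmain.trans ?_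
    have hmul : ENNReal.ofReal (J ^ (1 / p) * b ^ (1 - 1 / p) * (2 * R)) =
        ENNReal.ofReal J ^ (1 / p) * ENNReal.ofReal b ^ (1 - 1 / p) * ENNReal.ofReal (2 * R) := by
      rw [ENNReal.ofReal_mul (p := J ^ (1 / p) * b ^ (1 - 1 / p)) (by positivity),
        ENNReal.ofReal_mul (p := J ^ (1 / p)) (by positivity),
        ENNReal.ofReal_rpow_of_nonneg hJ0 (by positivity),
        ENNReal.ofReal_rpow_of_nonneg hb0.le hq]
    rw [ENNReal.ofReal_mul (q := k * _) zero_le_two, ENNReal.ofReal_mul hk0, hmul,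
      hk, ENNReal.ofReal_toReal hK, ENNReal.ofReal_ofNat]
    gcongr
  have hbpow : b ^ (1 - 1 / p) = b * (w ^ (-(1 / p)) * R ^ (-((n : ℝ) / p))) := by
    rw [sub_eq_add_neg, Real.rpow_add hb0, Real.rpow_one, hb,
      Real.mul_rpow (by positivity) hw0.le, ← Real.rpow_natCast R n, ← Real.rpow_mul hR.le,
      mul_comm (w ^ _)]
    ring_nf
  have hRpow : R ^ (1 - (n : ℝ) / p) = R * R ^ (-((n : ℝ) / p)) := by
    rw [sub_eq_add_neg, Real.rpow_add hR, Real.rpow_one]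
  have hJpow : J ^ (1 / p) = 2 ^ (-γ / p) * x i ^ (-γ / p) * A ^ (1 / p) := by
    rw [hJ, Real.mul_rpow (by positivity) hA0, ← Real.rpow_mul (by positivity), mul_one_div,
      Real.mul_rpow zero_le_two hx.le]
  rw [hbpow, hJpow] at hreal
  refine le_of_mul_le_mul_left (hreal.trans ?_) hb0
  rw [hRpow]
  calc
    _ = b * (4 * k * w ^ (-(1 / p)) * 2 ^ (-γ / p) * (R * R ^ (-((n : ℝ) / p))) *
          x i ^ (-γ / p) * A ^ (1 / p)) := by ring
    _ ≤ _ := by gcongr; linarith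

theorem abs_sub_boundary_le {p γ C A : ℝ} {u : EuclideanSpace ℝ (Fin n) → ℝ}
    (hcont : ContinuousOn u {z | 0 ≤ z i})
    (hball : ∀ (x y : EuclideanSpace ℝ (Fin n)) (R : ℝ), 0 < R → R ≤ x i → y ∈ Metric.ball x R →
      |u x - u y| ≤ C * R ^ (1 - (n : ℝ) / p) * x i ^ (-γ / p) * A)
    {x : EuclideanSpace ℝ (Fin n)} (hx : 0 < x i) :
    |u x - u (x - x i • EuclideanSpace.single i 1)| ≤
      C * x i ^ (1 - ((n : ℝ) + γ) / p) * A := by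
  set e : EuclideanSpace ℝ (Fin n) := EuclideanSpace.single i 1 with he
  have hei : e i = 1 := by simp [he]
  have hline : ContinuousOn (fun t : ℝ => |u x - u (x - (t * x i) • e)|) (Iic 1) := by
    refine (continuousOn_const.sub (hcont.comp (by fun_prop) ?_)).abs
    intro t ht
    have ht' : t ≤ 1 := ht
    change 0 ≤ (x - (t * x i) • e) i
    simp only [PiLp.sub_apply, PiLp.smul_apply, hei, smul_eq_mul, mul_one]
    nlinarith
  have hlim := ((hline 1 self_mem_Iic).mono Iio_subset_Iic_self).tendsto
  simp only [one_mul] at hlim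
  refine le_of_tendsto hlim ?_
  filter_upwards [Ioo_mem_nhdsLT (zero_lt_one (α := ℝ))] with t ht
  have hmem : x - (t * x i) • e ∈ Metric.ball x (x i) := by
    rw [Metric.mem_ball, dist_eq_norm, sub_sub_cancel_left, norm_neg, norm_smul, he,
      PiLp.norm_single, norm_one, mul_one, Real.norm_eq_abs,
      abs_of_pos (mul_pos ht.1 hx)]
    nlinarith [ht.2]
  refine (hball x _ _ hx le_rfl hmem).trans_eq ?_
  rw [mul_assoc C, ← Real.rpow_add hx]
  congr 3
  ring

end HalfSpace

theorem lastCoord_eq {n : ℕ} (hn : 0 < n) (z : EuclideanSpace ℝ (Fin n)) :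
    lastCoord n z = z ⟨n - 1, Nat.sub_lt hn one_pos⟩ :=
  dif_pos hn

theorem energy_eq {n : ℕ} (hn : 0 < n) {γ p : ℝ} (hp : 0 ≤ p)
    (u : EuclideanSpace ℝ (Fin n) → ℝ) :
    energy n γ p u =
      ∫⁻ z in {z : EuclideanSpace ℝ (Fin n) | 0 < z ⟨n - 1, Nat.sub_lt hn one_pos⟩},
        ‖fderiv ℝ u z‖ₑ ^ p * ENNReal.ofReal (z ⟨n - 1, Nat.sub_lt hn one_pos⟩ ^ γ) := by
  simp only [energy, upperHalf, lastCoord_eq hn]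
  refine lintegral_congr fun z => ?_
  rw [ENNReal.ofReal_mul (by positivity), ← ENNReal.ofReal_rpow_of_nonneg (norm_nonneg _) hp,
    ofReal_norm]

theorem one_le_two_rpow_mul_rpow_div {D N α : ℝ} (hN : 0 < N) (hα : 0 ≤ α) (h : N ≤ 2 * D) :
    1 ≤ 2 ^ α * (D ^ α / N ^ α) := by
  have hD : 0 < D := by linarith
  rw [← mul_div_assoc, one_le_div (by positivity), ← Real.mul_rpow zero_le_two hD.le]
  exact Real.rpow_le_rpow hN.le h hα

/-- Weighted Morrey–Sobolev inequality on the half-space, case `γ ≤ -1`. -/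
theorem weighted_morrey_sobolev_le_neg_one (n : ℕ) (hn : 1 ≤ n) (p γ : ℝ)
    (hnp : (n : ℝ) < p) (hγ : γ ≤ -1) :
    ∃ C : ℝ, 0 < C ∧
      ∀ u : EuclideanSpace ℝ (Fin n) → ℝ,
        ContinuousOn u {z | 0 ≤ lastCoord n z} →
        ContDiffOn ℝ 1 u (upperHalf n) →
        energy n γ p u < ⊤ →
        ∀ x ∈ upperHalf n, ∀ y ∈ upperHalf n,
          |u x - u y| ≤
            C * (max (lastCoord n x) (lastCoord n y) ^ (1 - ((n : ℝ) + γ) / p) *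
                ‖x - y‖ ^ (1 - (n : ℝ) / p) /
                max (max (lastCoord n x) (lastCoord n y)) ‖x - y‖ ^ (1 - (n : ℝ) / p)) *
              (energy n γ p u).toReal ^ (1 / p) := by
  have hn1 : (1 : ℝ) ≤ n := by exact_mod_cast hn
  have hp : 1 < p := by linarith
  have hp0 : 0 < p := by linarith
  have hα : 0 ≤ 1 - (n : ℝ) / p := by
    rw [sub_nonneg, div_le_one hp0]
    exact hnp.le
  have hβ : 0 ≤ 1 - ((n : ℝ) + γ) / p := by
    rw [sub_nonneg, div_le_one hp0]
    linarith
  set i : Fin n := ⟨n - 1, Nat.sub_lt hn one_pos⟩ with hi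
  obtain ⟨C, hC, hlocal⟩ := exists_abs_sub_le_ball i (γ := γ) hnp hp (by linarith)
  set α := 1 - (n : ℝ) / p with hαdef
  refine ⟨2 * C * 2 ^ α, by positivity, ?_⟩
  intro u hcont hu hfin
  simp only [energy_eq hn hp0.le, lastCoord_eq hn, upperHalf, ← hi] at hcont hu hfin ⊢
  have hball := hlocal u hu hfin.ne
  set A := (∫⁻ z in {z : EuclideanSpace ℝ (Fin n) | 0 < z i},
    ‖fderiv ℝ u z‖ₑ ^ p * ENNReal.ofReal (z i ^ γ)).toReal ^ (1 / p) with hA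
  have hA0 : 0 ≤ A := by positivity
  intro x hx y hy
  replace hx : 0 < x i := hx
  replace hy : 0 < y i := hy
  set M := max (x i) (y i) with hM
  have hM0 : 0 < M := lt_max_of_lt_left hx
  set D := ‖x - y‖ with hD
  have hD0 : 0 ≤ D := norm_nonneg _
  rcases le_or_gt (2 * D) M with hDM | hDM
  · rcases hD0.eq_or_lt with hD00 | hDpos
    · have hxy : x = y := sub_eq_zero.1 (norm_eq_zero.1 hD00.symm)
      rw [hxy, sub_self, abs_zero]
      positivity
    have hnear : |u x - u y| ≤ C * (2 * D) ^ α * M ^ (-γ / p) * A := by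
      rcases max_choice (x i) (y i) with h | h
      · rw [hM, h] at hDM ⊢
        refine hball x y _ (by positivity) hDM ?_
        rw [Metric.mem_ball, dist_comm, dist_eq_norm]
        linarith
      · rw [hM, h] at hDM ⊢
        rw [abs_sub_comm]
        refine hball y x _ (by positivity) hDM ?_
        rw [Metric.mem_ball, dist_eq_norm]
        linarith
    have hmax : max M D = M := max_eq_left (by linarith)
    have hpow : M ^ (1 - ((n : ℝ) + γ) / p) = M ^ (-γ / p) * M ^ α := by
      rw [← Real.rpow_add hM0, hαdef]
      congr 1
      ring
    have hMα : M ^ α ≠ 0 := by positivity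
    refine hnear.trans ?_
    rw [hmax, hpow, Real.mul_rpow zero_le_two hD0]
    have hrw : M ^ (-γ / p) * M ^ α * D ^ α / M ^ α = M ^ (-γ / p) * D ^ α := by
      field_simp
    rw [hrw]
    have hnn : 0 ≤ C * 2 ^ α * (M ^ (-γ / p) * D ^ α) * A := by positivity
    linarith
  · have htrace : u (x - x i • EuclideanSpace.single i 1) =
        u (y - y i • EuclideanSpace.single i 1) :=
      eq_of_coord_eq_zero hp hγ hcont hu hfin.ne (by simp) (by simp)
    have hxb := abs_sub_boundary_le hcont hball hx
    have hyb := abs_sub_boundary_le hcont hball hy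
    rw [← htrace] at hyb
    have hxM : x i ^ (1 - ((n : ℝ) + γ) / p) ≤ M ^ (1 - ((n : ℝ) + γ) / p) :=
      Real.rpow_le_rpow hx.le (le_max_left _ _) hβ
    have hyM : y i ^ (1 - ((n : ℝ) + γ) / p) ≤ M ^ (1 - ((n : ℝ) + γ) / p) :=
      Real.rpow_le_rpow hy.le (le_max_right _ _) hβ
    have hratio := one_le_two_rpow_mul_rpow_div (N := max M D) (lt_max_of_lt_left hM0) hα
      (max_le hDM.le (by linarith))
    calc
      |u x - u y| ≤ C * x i ^ (1 - ((n : ℝ) + γ) / p) * A +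
          C * y i ^ (1 - ((n : ℝ) + γ) / p) * A := by
        refine (abs_sub_le _ (u (x - x i • EuclideanSpace.single i 1)) _).trans ?_
        rw [abs_sub_comm _ (u y)]
        exact add_le_add hxb hyb
      _ ≤ C * M ^ (1 - ((n : ℝ) + γ) / p) * A + C * M ^ (1 - ((n : ℝ) + γ) / p) * A := by
        gcongr
      _ = 2 * C * M ^ (1 - ((n : ℝ) + γ) / p) * A * 1 := by ring
      _ ≤ 2 * C * M ^ (1 - ((n : ℝ) + γ) / p) * A * (2 ^ α * (D ^ α / max M D ^ α)) := by
        gcongr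
      _ = _ := by ring
end
end
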